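/- arXiv:2604.06910 — 2 statements merged into one kernel-verified Lean document; each statement's English description precedes it below -/
import Mathlib

section
/- Let K, b, c be real numbers with K ≤ 0 and b + c*√(-K) ≤ 0. Set n_x = 1/√(1-K) and n_y = -√(-K)/√(1-K). Then for all real t₁, t₂: K*(b*n_x - c*n_y)*t₁² + 2*(b*n_y + K*c*n_x)*t₁*t₂ - (b*n_x - c*n_y)*t₂² ≥ 0; that is, the symmetric matrix M with entries M₁₁ = K*(b*n_x - c*n_y), M₁₂ = M₂₁ = b*n_y + K*c*n_x, M₂₂ = -(b*n_x - c*n_y) is positive semidefinite. -/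
theorem stmt_5 (K b c : ℝ) (hK : K ≤ 0) (hbc : b + c * Real.sqrt (-K) ≤ 0)
    (n_x n_y : ℝ)
    (hnx : n_x = 1 / Real.sqrt (1 - K))
    (hny : n_y = -Real.sqrt (-K) / Real.sqrt (1 - K)) :
    ∀ t₁ t₂ : ℝ,
      0 ≤ K * (b * n_x - c * n_y) * t₁ ^ 2
        + 2 * (b * n_y + K * c * n_x) * t₁ * t₂
        - (b * n_x - c * n_y) * t₂ ^ 2 := by
  intro t₁ t₂
  have hs : Real.sqrt (-K) ^ 2 = -K := Real.sq_sqrt (by linarith)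
  have hr : 0 ≤ (Real.sqrt (1 - K))⁻¹ := inv_nonneg.mpr (Real.sqrt_nonneg _)
  rw [hnx, hny, one_div, div_eq_mul_inv]
  generalize Real.sqrt (-K) = s at *
  generalize (Real.sqrt (1 - K))⁻¹ = r at *
  obtain rfl : K = -s ^ 2 := by linarith
  calc
    0 ≤ r * -(b + c * s) * (s * t₁ + t₂) ^ 2 :=
      mul_nonneg (mul_nonneg hr (neg_nonneg.mpr hbc)) (sq_nonneg _)
    _ = _ := by ring
end

section
/- Let c₀, c₁, d be positive real numbers, set b₁ = 2*c₁, and let b₀ be a real number with 2*c₁ + (3/2)^(1/3)*c₀ ≤ -b₀ ≤ c₁ + c₀/d. Then: (i) for all y ∈ [-(3/2)^(2/3), d], (2*c₁ - b₁)*y + c₀ > 0; (ii) b₁ - c₁ > 0; (iii) for all y ∈ [-(3/2)^(2/3), 0], b₀ + b₁ - ((2/3)*b₁ + c₁)*(-y)^(3/2) + c₀*√(-y) ≤ 0; (iv) for all x ∈ [0, 1], (b₁ - c₁)*x*d + c₀ + c₁*d ≥ |b₀|*d. -/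
theorem stmt_11 (c₀ c₁ d : ℝ) (hc₀ : 0 < c₀) (hc₁ : 0 < c₁) (hd : 0 < d)
    (b₁ : ℝ) (hb₁ : b₁ = 2 * c₁) (b₀ : ℝ)
    (hlow : 2 * c₁ + ((3 : ℝ) / 2) ^ ((1 : ℝ) / 3) * c₀ ≤ -b₀)
    (hhigh : -b₀ ≤ c₁ + c₀ / d) :
    (∀ y : ℝ, -((3 : ℝ) / 2) ^ ((2 : ℝ) / 3) ≤ y → y ≤ d →
        0 < (2 * c₁ - b₁) * y + c₀)
    ∧ 0 < b₁ - c₁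
    ∧ (∀ y : ℝ, -((3 : ℝ) / 2) ^ ((2 : ℝ) / 3) ≤ y → y ≤ 0 →
        b₀ + b₁ - ((2 / 3) * b₁ + c₁) * (-y) ^ ((3 : ℝ) / 2)
          + c₀ * Real.sqrt (-y) ≤ 0)
    ∧ (∀ x : ℝ, 0 ≤ x → x ≤ 1 →
        |b₀| * d ≤ (b₁ - c₁) * x * d + c₀ + c₁ * d) := by
  subst hb₁
  have hr : (0 : ℝ) < ((3 : ℝ) / 2) ^ ((1 : ℝ) / 3) := by positivity
  refine ⟨fun y _ _ => by linarith, by linarith, fun y hy hy0 => ?_, fun x hx _ => ?_⟩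
  · have hsqrt : Real.sqrt (-y) ≤ ((3 : ℝ) / 2) ^ ((1 : ℝ) / 3) := by
      refine Real.sqrt_le_iff.mpr ⟨hr.le, ?_⟩
      rw [← Real.rpow_natCast, ← Real.rpow_mul (by norm_num)]
      norm_num at hy ⊢
      linarith
    have hpow : 0 ≤ (-y) ^ ((3 : ℝ) / 2) := Real.rpow_nonneg (by linarith) _
    have hcoef : 0 ≤ ((2 / 3) * (2 * c₁) + c₁) * (-y) ^ ((3 : ℝ) / 2) := by positivity
    linarith [mul_le_mul_of_nonneg_left hsqrt hc₀.le]
  · have hb₀ : b₀ < 0 := by linarith [mul_pos hr hc₀]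
    rw [abs_of_neg hb₀]
    have hmul : -b₀ * d ≤ c₁ * d + c₀ := by
      calc -b₀ * d ≤ (c₁ + c₀ / d) * d := by gcongr
        _ = c₁ * d + c₀ := by field_simp
    have hx' : 0 ≤ (2 * c₁ - c₁) * x * d := by
      have : 0 ≤ 2 * c₁ - c₁ := by linarith
      positivity
    linarith
end
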